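/- arXiv:0710.0872 — 3 statements merged into one kernel-verified Lean document; each statement's English description precedes it below -/
import Mathlib

section
/- Let b > 0, δ > 0, η > 0 and 0 ≤ v < 1 be real constants, let y : [0,1] × [0,∞) → ℝ be continuously differentiable with y(0,t) = y(1,t) = 0 for all t ≥ 0, and define E(t) = ∫₀¹ [ (1/2) y_t(x,t)² + (1/2)(1−v²) y_x(x,t)² + (b/8) y_x(x,t)⁴ ] dx, V(t) = E(t) + δ ∫₀¹ [ y(x,t) y_t(x,t) + δ y(x,t)² + (η/4) y_x(x,t)⁴ ] dx, and K = 1 + δ · max{ (1 + 2δ/π)/(π(1 − v²)), 2η/b }. Then for every t ≥ 0 one has 0 ≤ V(t) ≤ K · E(t). -/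
open Real

/-- Partial derivative with respect to the first (spatial) variable. -/
noncomputable def pdx (y : ℝ → ℝ → ℝ) (x t : ℝ) : ℝ := deriv (fun x' => y x' t) x

/-- Partial derivative with respect to the second (time) variable. -/
noncomputable def pdt (y : ℝ → ℝ → ℝ) (x t : ℝ) : ℝ := deriv (fun t' => y x t') t

/-- If `f` and `s` vanish at `a` and `s` vanishes only to first order there, then `f ^ 2 / s` is
continuous at `a`. -/
theorem continuousAt_sq_div_of_hasDerivAt {f s : ℝ → ℝ} {a f' s' : ℝ} (hf : HasDerivAt f f' a)
    (hs : HasDerivAt s s' a) (hfa : f a = 0) (hsa : s a = 0) (hs' : s' ≠ 0) :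
    ContinuousAt (fun x => f x ^ 2 / s x) a := by
  have h : (fun x => f x ^ 2 / s x) = fun x => f x * (dslope f a x / dslope s a x) := by
    funext x
    rcases eq_or_ne x a with rfl | hx
    · simp [hfa]
    · have hxa : x - a ≠ 0 := sub_ne_zero.2 hx
      rw [dslope_of_ne _ hx, dslope_of_ne _ hx, slope_def_field, slope_def_field, hfa, hsa,
        sub_zero, sub_zero, div_div_div_cancel_right₀ hxa]
      ring
  rw [h]
  refine hf.continuousAt.mul (ContinuousAt.div (continuousAt_dslope_same.2 hf.differentiableAt)
    (continuousAt_dslope_same.2 hs.differentiableAt) ?_)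
  rwa [dslope_same, hs.deriv]

/-- Wirtinger's inequality on the unit interval with Dirichlet boundary conditions. -/
theorem wirtinger_inequality_unitInterval {f f' : ℝ → ℝ} (hf : ∀ x, HasDerivAt f (f' x) x)
    (hf' : Continuous f') (h0 : f 0 = 0) (h1 : f 1 = 0) :
    π ^ 2 * ∫ x in (0:ℝ)..1, f x ^ 2 ≤ ∫ x in (0:ℝ)..1, f' x ^ 2 := by
  have hfc : Continuous f := continuous_iff_continuousAt.2 fun x => (hf x).continuousAt
  have hπx (x : ℝ) : HasDerivAt (fun x => π * x) π x := by
    simpa using (hasDerivAt_id x).const_mul π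
  have hsin (x : ℝ) : HasDerivAt (fun x => sin (π * x)) (cos (π * x) * π) x := (hπx x).sin
  have hcos (x : ℝ) : HasDerivAt (fun x => cos (π * x)) (-sin (π * x) * π) x := (hπx x).cos
  have hpos : ∀ x ∈ Set.Ioo (0:ℝ) 1, 0 < sin (π * x) := fun x hx =>
    sin_pos_of_pos_of_lt_pi (mul_pos pi_pos hx.1) (by nlinarith [pi_pos, hx.2])
  set g : ℝ → ℝ := fun x => π * cos (π * x) * (f x ^ 2 / sin (π * x)) with hg
  have hgc : ContinuousOn g (Set.Icc 0 1) := by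
    intro x hx
    refine ContinuousAt.continuousWithinAt (ContinuousAt.mul (by fun_prop) ?_)
    rcases eq_or_lt_of_le hx.1 with rfl | hx0
    · exact continuousAt_sq_div_of_hasDerivAt (hf 0) (hsin 0) h0 (by simp) (by simp [pi_ne_zero])
    rcases eq_or_lt_of_le hx.2 with rfl | hx1
    · exact continuousAt_sq_div_of_hasDerivAt (hf 1) (hsin 1) h1 (by simp) (by simp [pi_ne_zero])
    · exact ContinuousAt.div (by fun_prop) (by fun_prop) (hpos x ⟨hx0, hx1⟩).ne'
  have hint : Continuous fun x => f' x ^ 2 - π ^ 2 * f x ^ 2 := by fun_prop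
  have key := intervalIntegral.sub_le_integral_of_hasDeriv_right_of_le (zero_le_one' ℝ) hgc
    (g' := fun x => f' x ^ 2 - π ^ 2 * f x ^ 2
      - (f' x - π * cos (π * x) / sin (π * x) * f x) ^ 2)
    (φ := fun x => f' x ^ 2 - π ^ 2 * f x ^ 2) (fun x hx => ?_)
    (hint.continuousOn.integrableOn_Icc) (fun x _ => sub_le_self _ (sq_nonneg _))
  · rw [intervalIntegral.integral_sub (Continuous.intervalIntegrable (by fun_prop) _ _)
      (Continuous.intervalIntegrable (by fun_prop) _ _),
      intervalIntegral.integral_const_mul] at key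
    simp only [hg, h0, h1] at key
    norm_num at key
    exact key
  · have hs := (hpos x hx).ne'
    have hd := ((hcos x).const_mul π).mul (((hf x).pow 2).div (hsin x) hs)
    refine (hd.congr_deriv ?_).hasDerivWithinAt
    simp only [Pi.pow_apply, Pi.div_apply]
    field_simp
    ring

theorem hasDerivAt_pdx {y : ℝ → ℝ → ℝ} (hy : ContDiff ℝ 1 (Function.uncurry y)) (x t : ℝ) :
    HasDerivAt (fun x' => y x' t) (pdx y x t) x := by
  have h : Differentiable ℝ fun x' => Function.uncurry y (x', t) :=
    (hy.differentiable one_ne_zero).comp (by fun_prop)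
  exact (h x).hasDerivAt

theorem continuous_pdx {y : ℝ → ℝ → ℝ} (hy : ContDiff ℝ 1 (Function.uncurry y)) (t : ℝ) :
    Continuous fun x => pdx y x t := by
  have h : ContDiff ℝ 1 fun x' => Function.uncurry y (x', t) := hy.comp (by fun_prop)
  exact h.continuous_deriv le_rfl

theorem continuous_pdt {y : ℝ → ℝ → ℝ} (hy : ContDiff ℝ 1 (Function.uncurry y)) (t : ℝ) :
    Continuous fun x => pdt y x t := by
  have h (x : ℝ) : pdt y x t = fderiv ℝ (Function.uncurry y) (x, t) (0, 1) := by
    have hd := (hy.differentiable one_ne_zero (x, t)).hasFDerivAt.comp_hasDerivAt t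
      ((hasDerivAt_const t x).prodMk (hasDerivAt_id t))
    exact hd.deriv
  simp only [h]
  have := hy.continuous_fderiv one_ne_zero
  fun_prop

/-- For the energy `E` and Lyapunov function `V` of the moving string with
Kelvin–Voigt damping, `0 ≤ V(t) ≤ K E(t)` for all `t ≥ 0`. -/
theorem stmt_0 (b δ η v : ℝ) (hb : 0 < b) (hδ : 0 < δ) (hη : 0 < η)
    (hv0 : 0 ≤ v) (hv1 : v < 1)
    (y : ℝ → ℝ → ℝ)
    (hy : ContDiff ℝ 1 (Function.uncurry y))
    (hbc : ∀ t : ℝ, 0 ≤ t → y 0 t = 0 ∧ y 1 t = 0)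
    (E V : ℝ → ℝ)
    (hE : ∀ t : ℝ, E t = ∫ x in (0:ℝ)..1,
      ((1/2) * (pdt y x t) ^ 2 + (1/2) * (1 - v ^ 2) * (pdx y x t) ^ 2
        + (b/8) * (pdx y x t) ^ 4))
    (hV : ∀ t : ℝ, V t = E t + δ * ∫ x in (0:ℝ)..1,
      (y x t * pdt y x t + δ * (y x t) ^ 2 + (η/4) * (pdx y x t) ^ 4))
    (K : ℝ)
    (hK : K = 1 + δ * max ((1 + 2 * δ / π) / (π * (1 - v ^ 2))) (2 * η / b)) :
    ∀ t : ℝ, 0 ≤ t → 0 ≤ V t ∧ V t ≤ K * E t := by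
  intro t ht
  obtain ⟨h0, h1⟩ := hbc t ht
  have hW := wirtinger_inequality_unitInterval (fun x => hasDerivAt_pdx hy x t)
    (continuous_pdx hy t) h0 h1
  have hcx := continuous_pdx hy t
  have hct := continuous_pdt hy t
  have hcy : Continuous fun x => y x t :=
    continuous_iff_continuousAt.2 fun x => (hasDerivAt_pdx hy x t).continuousAt
  have ha : 0 < 1 - v ^ 2 := by nlinarith
  have hπ := pi_pos
  constructor
  · rw [hV, hE, ← intervalIntegral.integral_const_mul, ← intervalIntegral.integral_add
      (Continuous.intervalIntegrable (by fun_prop) _ _)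
      (Continuous.intervalIntegrable (by fun_prop) _ _)]
    refine intervalIntegral.integral_nonneg zero_le_one fun x _ => ?_
    have hsplit : 0 ≤ (1/2) * (pdt y x t + δ * y x t) ^ 2 + (1/2) * (δ * y x t) ^ 2
        + (1/2) * (1 - v ^ 2) * (pdx y x t) ^ 2 + (b/8) * (pdx y x t) ^ 4
        + δ * ((η/4) * (pdx y x t) ^ 4) := by positivity
    linarith
  set M := max ((1 + 2 * δ / π) / (π * (1 - v ^ 2))) (2 * η / b)
  have hM1 : 1 + 2 * δ / π ≤ M * (π * (1 - v ^ 2)) :=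
    (div_le_iff₀ (by positivity)).1 (le_max_left _ _)
  have hM2 : 2 * η ≤ M * b := (div_le_iff₀ hb).1 (le_max_right _ _)
  have hM0 : 0 ≤ M := le_trans (by positivity) (le_max_right _ _)
  have hMπ : 1 / π ≤ M := by
    rw [div_le_iff₀ hπ]
    have : 0 ≤ 2 * δ / π := by positivity
    nlinarith [mul_nonneg (mul_nonneg hM0 hπ.le) (sq_nonneg v)]
  have hMa : (1 + 2 * δ / π) / π ≤ M * (1 - v ^ 2) := by
    rw [div_le_iff₀ hπ]
    linarith
  suffices h : ∫ x in (0:ℝ)..1, (y x t * pdt y x t + δ * (y x t) ^ 2 + (η/4) * (pdx y x t) ^ 4)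
      ≤ M * E t by
    rw [hV, hK]
    linarith [mul_le_mul_of_nonneg_left h hδ.le]
  have hpt : ∫ x in (0:ℝ)..1, (y x t * pdt y x t + δ * (y x t) ^ 2 + (η/4) * (pdx y x t) ^ 4)
      ≤ ∫ x in (0:ℝ)..1, (M * ((1/2) * (pdt y x t) ^ 2 + (1/2) * (1 - v ^ 2) * (pdx y x t) ^ 2
        + (b/8) * (pdx y x t) ^ 4)
        + (1 + 2 * δ / π) / π / 2 * (π ^ 2 * (y x t) ^ 2 - (pdx y x t) ^ 2)) := by
    refine intervalIntegral.integral_mono_on zero_le_one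
      (Continuous.intervalIntegrable (by fun_prop) _ _)
      (Continuous.intervalIntegrable (by fun_prop) _ _) fun x _ => ?_
    have hyoung : y x t * pdt y x t ≤ π / 2 * (y x t) ^ 2 + 1 / π / 2 * (pdt y x t) ^ 2 := by
      have hsq : π / 2 * (y x t) ^ 2 + 1 / π / 2 * (pdt y x t) ^ 2 - y x t * pdt y x t
          = 1 / π / 2 * (π * y x t - pdt y x t) ^ 2 := by
        field_simp
        ring
      have : 0 ≤ 1 / π / 2 * (π * y x t - pdt y x t) ^ 2 := by positivity
      linarith
    have hcoef : (1 + 2 * δ / π) / π / 2 * (π ^ 2 * (y x t) ^ 2)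
        = π / 2 * (y x t) ^ 2 + δ * (y x t) ^ 2 := by
      field_simp
    have e1 := mul_le_mul_of_nonneg_right hMπ (sq_nonneg (pdt y x t))
    have e2 := mul_le_mul_of_nonneg_right hMa (sq_nonneg (pdx y x t))
    have e3 := mul_le_mul_of_nonneg_right hM2 (by positivity : 0 ≤ (pdx y x t) ^ 4)
    linarith
  refine hpt.trans ?_
  rw [intervalIntegral.integral_add (Continuous.intervalIntegrable (by fun_prop) _ _)
    (Continuous.intervalIntegrable (by fun_prop) _ _), intervalIntegral.integral_const_mul,
    intervalIntegral.integral_const_mul, intervalIntegral.integral_sub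
    (Continuous.intervalIntegrable (by fun_prop) _ _)
    (Continuous.intervalIntegrable (by fun_prop) _ _), intervalIntegral.integral_const_mul,
    ← hE]
  have hc : 0 ≤ (1 + 2 * δ / π) / π / 2 := by positivity
  linarith [mul_nonneg hc (sub_nonneg.2 hW)]
end

section
/- Let u : [0,1] → ℝ be continuously differentiable with u(0) = u(1) = 0. Then ∫₀¹ u(x)² dx ≤ (1/π²) ∫₀¹ u'(x)² dx. -/
open Real

/-- Picone-type argument: comparing `u` with `x ↦ cos (k * (x - (a + b) / 2))`, which has no zero
on `[a, b]` when `k * (b - a) < π`. -/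
theorem sq_mul_integral_sq_le_integral_deriv_sq {u : ℝ → ℝ} (hu : ContDiff ℝ 1 u) {a b k : ℝ}
    (hab : a ≤ b) (ha : u a = 0) (hb : u b = 0) (hk : 0 ≤ k) (hkπ : k * (b - a) < π) :
    k ^ 2 * ∫ x in a..b, u x ^ 2 ≤ ∫ x in a..b, deriv u x ^ 2 := by
  set θ : ℝ → ℝ := fun x => k * (x - (a + b) / 2) with hθ
  have hcos : ∀ x ∈ Set.Icc a b, cos (θ x) ≠ 0 := by
    rintro x ⟨hax, hxb⟩
    refine (cos_pos_of_mem_Ioo ⟨?_, ?_⟩).ne' <;> simp only [hθ] <;> nlinarith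
  have hu' : Continuous (deriv u) := hu.continuous_deriv le_rfl
  have huc : Continuous u := hu.continuous
  have hderiv : ∀ x, HasDerivAt u (deriv u x) x := fun x =>
    (hu.differentiable one_ne_zero x).hasDerivAt
  have hθd : ∀ x, HasDerivAt θ k x := fun x => by
    simpa using ((hasDerivAt_id x).sub_const ((a + b) / 2)).const_mul k
  have hθc : Continuous θ := by fun_prop
  have htan : ContinuousOn (fun x => tan (θ x)) (Set.Icc a b) :=
    continuousOn_tan.comp hθc.continuousOn hcos
  set w' : ℝ → ℝ := fun x =>
    2 * k * u x * deriv u x * tan (θ x) + k ^ 2 * u x ^ 2 * (1 + tan (θ x) ^ 2) with hw'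
  have hw'c : ContinuousOn w' (Set.Icc a b) := by fun_prop
  have hw : ∀ x ∈ Set.uIcc a b, HasDerivAt (fun y => k * u y ^ 2 * tan (θ y)) (w' x) x := by
    intro x hx
    rw [Set.uIcc_of_le hab] at hx
    have hc := hcos x hx
    have h := (((hderiv x).pow 2).const_mul k).mul ((hasDerivAt_tan hc).comp x (hθd x))
    refine h.congr_deriv ?_
    have hsec : 1 / cos (θ x) ^ 2 = 1 + tan (θ x) ^ 2 := by
      rw [tan_eq_sin_div_cos]
      field_simp
      rw [cos_sq_add_sin_sq]
    simp only [hw', hsec, Function.comp_apply, Pi.pow_apply]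
    push_cast
    ring
  have hw'i : IntervalIntegrable w' MeasureTheory.volume a b :=
    hw'c.intervalIntegrable_of_Icc hab
  have hw'0 : ∫ x in a..b, w' x = 0 := by
    rw [intervalIntegral.integral_eq_sub_of_hasDerivAt hw hw'i]
    simp [ha, hb]
  have hui : IntervalIntegrable (fun x => k ^ 2 * u x ^ 2) MeasureTheory.volume a b :=
    (by fun_prop : Continuous fun x => k ^ 2 * u x ^ 2).intervalIntegrable a b
  calc k ^ 2 * ∫ x in a..b, u x ^ 2
      = ∫ x in a..b, (k ^ 2 * u x ^ 2 - w' x) := by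
        rw [intervalIntegral.integral_sub hui hw'i, hw'0, sub_zero,
          intervalIntegral.integral_const_mul]
    _ ≤ ∫ x in a..b, deriv u x ^ 2 := by
        refine intervalIntegral.integral_mono_on hab (hui.sub hw'i)
          ((hu'.pow 2).intervalIntegrable a b) fun x _ => ?_
        simp only [hw']
        nlinarith [sq_nonneg (deriv u x + k * u x * tan (θ x))]

/-- Scheefer's (Poincaré–Wirtinger) inequality: for a continuously differentiable
function `u` on `[0,1]` with `u 0 = u 1 = 0`,
`∫₀¹ u² dx ≤ (1/π²) ∫₀¹ (u')² dx`. -/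
theorem stmt_9 (u : ℝ → ℝ)
    (hu : ContDiff ℝ 1 u)
    (h0 : u 0 = 0) (h1 : u 1 = 0) :
    (∫ x in (0:ℝ)..1, (u x) ^ 2)
      ≤ (1 / π ^ 2) * ∫ x in (0:ℝ)..1, (deriv u x) ^ 2 := by
  have hle : ∀ᶠ k in nhdsWithin π (Set.Iio π),
      k ^ 2 * ∫ x in (0:ℝ)..1, u x ^ 2 ≤ ∫ x in (0:ℝ)..1, deriv u x ^ 2 := by
    filter_upwards [Ioo_mem_nhdsLT pi_pos] with k hk
    exact sq_mul_integral_sq_le_integral_deriv_sq hu zero_le_one h0 h1 hk.1.le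
      (by simpa using hk.2)
  have hlim : Filter.Tendsto (fun k : ℝ => k ^ 2 * ∫ x in (0:ℝ)..1, u x ^ 2)
      (nhdsWithin π (Set.Iio π)) (nhds (π ^ 2 * ∫ x in (0:ℝ)..1, u x ^ 2)) :=
    Continuous.continuousWithinAt (by fun_prop)
  rw [one_div, ← div_eq_inv_mul, le_div_iff₀' (by positivity)]
  exact le_of_tendsto hlim hle
end

section
/- Let b > 0, δ > 0, η > 0 and 0 ≤ v < 1 be real constants, and let y : [0,1] × [0,∞) → ℝ be a sufficiently smooth (of class C³) solution of the PDE y_tt + 2δ y_t + 2v y_xt = (1 − v² + (3/2) b y_x²) y_xx + 2η y_x y_xx y_xt + η y_x² y_xxt on (0,1) × [0,∞) with boundary conditions y(0,t) = y(1,t) = 0 for all t ≥ 0. Define V(t) = ∫₀¹ [ (1/2) y_t² + (1/2)(1−v²) y_x² + (b/8) y_x⁴ ] dx + δ ∫₀¹ [ y y_t + δ y² + (η/4) y_x⁴ ] dx. Then t ↦ V(t) is differentiable on [0,∞) and for every t ≥ 0 its derivative satisfies V′(t) ≤ −δ(1 − v) ∫₀¹ y_t(x,t)² dx − δ(1 −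 v − v²) ∫₀¹ y_x(x,t)² dx − (bδ/2) ∫₀¹ y_x(x,t)⁴ dx − η ∫₀¹ y_x(x,t)² y_xt(x,t)² dx. -/
open Real

section PartialDerivatives

variable {f : ℝ → ℝ → ℝ} {n : ℕ}

theorem pdx_hasDerivAt (hf : ContDiff ℝ (n + 1) (Function.uncurry f)) (x t : ℝ) :
    HasDerivAt (fun x' => f x' t) (pdx f x t) x := by
  have hd : Differentiable ℝ (Function.uncurry f) := hf.differentiable (by simp)
  have h : Differentiable ℝ (fun x' => f x' t) :=
    hd.comp (differentiable_id.prodMk (differentiable_const t))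
  exact (h x).hasDerivAt

theorem pdt_hasDerivAt (hf : ContDiff ℝ (n + 1) (Function.uncurry f)) (x t : ℝ) :
    HasDerivAt (fun t' => f x t') (pdt f x t) t := by
  have hd : Differentiable ℝ (Function.uncurry f) := hf.differentiable (by simp)
  have h : Differentiable ℝ (fun t' => f x t') :=
    hd.comp ((differentiable_const x).prodMk differentiable_id)
  exact (h t).hasDerivAt

theorem pdx_eq_fderiv (hf : ContDiff ℝ (n + 1) (Function.uncurry f)) :
    Function.uncurry (pdx f) = fun p => fderiv ℝ (Function.uncurry f) p (1, 0) := by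
  have hd : Differentiable ℝ (Function.uncurry f) := hf.differentiable (by simp)
  funext ⟨x, t⟩
  have hl : HasDerivAt (fun x' : ℝ => (x', t)) ((1 : ℝ), (0 : ℝ)) x :=
    (hasDerivAt_id x).prodMk (hasDerivAt_const x t)
  exact (pdx_hasDerivAt hf x t).unique
    (HasFDerivAt.comp_hasDerivAt (f := fun x' : ℝ => (x', t)) x (hd (x, t)).hasFDerivAt hl)

theorem pdt_eq_fderiv (hf : ContDiff ℝ (n + 1) (Function.uncurry f)) :
    Function.uncurry (pdt f) = fun p => fderiv ℝ (Function.uncurry f) p (0, 1) := by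
  have hd : Differentiable ℝ (Function.uncurry f) := hf.differentiable (by simp)
  funext ⟨x, t⟩
  have hl : HasDerivAt (fun t' : ℝ => (x, t')) ((0 : ℝ), (1 : ℝ)) t :=
    (hasDerivAt_const t x).prodMk (hasDerivAt_id t)
  exact (pdt_hasDerivAt hf x t).unique
    (HasFDerivAt.comp_hasDerivAt (f := fun t' : ℝ => (x, t')) t (hd (x, t)).hasFDerivAt hl)

theorem pdx_contDiff (hf : ContDiff ℝ (n + 1) (Function.uncurry f)) :
    ContDiff ℝ n (Function.uncurry (pdx f)) := by
  rw [pdx_eq_fderiv hf]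
  exact (hf.fderiv_right le_rfl).clm_apply contDiff_const

theorem pdt_contDiff (hf : ContDiff ℝ (n + 1) (Function.uncurry f)) :
    ContDiff ℝ n (Function.uncurry (pdt f)) := by
  rw [pdt_eq_fderiv hf]
  exact (hf.fderiv_right le_rfl).clm_apply contDiff_const

theorem pdt_pdx_comm (hf : ContDiff ℝ 2 (Function.uncurry f)) (x t : ℝ) :
    pdt (pdx f) x t = pdx (pdt f) x t := by
  have hf' : ContDiff ℝ ((1 : ℕ) + 1) (Function.uncurry f) := by
    convert hf using 1; norm_num
  have hX : ContDiff ℝ ((0 : ℕ) + 1) (Function.uncurry (pdx f)) := by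
    simpa using pdx_contDiff hf'
  have hT : ContDiff ℝ ((0 : ℕ) + 1) (Function.uncurry (pdt f)) := by
    simpa using pdt_contDiff hf'
  have hd : DifferentiableAt ℝ (fderiv ℝ (Function.uncurry f)) (x, t) :=
    (hf'.fderiv_right (m := (1 : ℕ)) le_rfl).differentiable (by simp) _
  have h1 := congrFun (pdt_eq_fderiv hX) (x, t)
  have h2 := congrFun (pdx_eq_fderiv hT) (x, t)
  rw [pdx_eq_fderiv hf', fderiv_clm_apply hd (differentiableAt_const _)] at h1
  rw [pdt_eq_fderiv hf', fderiv_clm_apply hd (differentiableAt_const _)] at h2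
  have hs := hf.contDiffAt.isSymmSndFDerivAt (x := (x, t)) (by simp)
  simp at h1 h2
  rw [h1, h2]
  exact hs _ _

end PartialDerivatives

theorem hasDerivAt_intervalIntegral_of_continuous {f f' : ℝ → ℝ → ℝ} {a b : ℝ}
    (hf : ∀ t, Continuous fun x => f x t) (hf' : Continuous (Function.uncurry f'))
    (h : ∀ x t, HasDerivAt (fun s => f x s) (f' x t) t) (t : ℝ) :
    HasDerivAt (fun s => ∫ x in a..b, f x s) (∫ x in a..b, f' x t) t := by
  obtain ⟨M, hM⟩ := ((isCompact_uIcc (a := a) (b := b)).prod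
    (isCompact_closedBall t 1)).exists_bound_of_continuousOn hf'.continuousOn
  refine (intervalIntegral.hasDerivAt_integral_of_dominated_loc_of_deriv_le
    (F := fun s x => f x s) (F' := fun s x => f' x s) (bound := fun _ => M)
    (Metric.closedBall_mem_nhds t one_pos)
    (Filter.Eventually.of_forall fun s => (hf s).aestronglyMeasurable)
    ((hf t).intervalIntegrable _ _)
    (hf'.comp (continuous_id.prodMk continuous_const)).aestronglyMeasurable
    (Filter.Eventually.of_forall fun x hx s hs => hM (x, s) ⟨Set.uIoc_subset_uIcc hx, hs⟩)
    intervalIntegrable_const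
    (Filter.Eventually.of_forall fun x _ s _ => h x s)).2

theorem pdt_eq_zero_of_forall_ge {f : ℝ → ℝ → ℝ} {x t : ℝ}
    (hf : HasDerivAt (fun s => f x s) (pdt f x t) t) (h : ∀ s, t ≤ s → f x s = 0) :
    pdt f x t = 0 :=
  (uniqueDiffWithinAt_Ici t).eq_deriv _ hf.hasDerivWithinAt
    ((hasDerivWithinAt_const t (Set.Ici t) (0 : ℝ)).congr (fun s hs => h s hs) (h t le_rfl))

/-- The dissipation inequality on a time slice: `Y, A, B, C, D, E, T` stand for
`y, y_t, y_x, y_xt, y_xx, y_xxt, y_tt` at a fixed time. -/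
theorem slice_dissipation_le {b δ η v : ℝ} (hδ : 0 < δ) (hv0 : 0 ≤ v)
    {Y A B C D E T : ℝ → ℝ} (hYB : ∀ x, HasDerivAt Y (B x) x) (hAC : ∀ x, HasDerivAt A (C x) x)
    (hBD : ∀ x, HasDerivAt B (D x) x) (hCE : ∀ x, HasDerivAt C (E x) x)
    (hE : Continuous E) (hD : Continuous D) (hT : Continuous T)
    (hpde : ∀ x ∈ Set.Ioo (0 : ℝ) 1, T x + 2 * δ * A x + 2 * v * C x
      = (1 - v ^ 2 + (3 / 2) * b * B x ^ 2) * D x + 2 * η * B x * D x * C x + η * B x ^ 2 * E x)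
    (hY0 : Y 0 = 0) (hY1 : Y 1 = 0) (hA0 : A 0 = 0) (hA1 : A 1 = 0) :
    (∫ x in (0 : ℝ)..1, (A x * T x + (1 - v ^ 2) * (B x * C x) + (b / 2) * (B x ^ 3 * C x)))
      + δ * (∫ x in (0 : ℝ)..1,
        (A x ^ 2 + Y x * T x + 2 * δ * (Y x * A x) + η * (B x ^ 3 * C x)))
      ≤ -(δ * (1 - v)) * (∫ x in (0 : ℝ)..1, A x ^ 2)
        - δ * (1 - v - v ^ 2) * (∫ x in (0 : ℝ)..1, B x ^ 2)
        - (b * δ / 2) * (∫ x in (0 : ℝ)..1, B x ^ 4)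
        - η * ∫ x in (0 : ℝ)..1, B x ^ 2 * C x ^ 2 := by
  have cY : Continuous Y := continuous_iff_continuousAt.2 fun x => (hYB x).continuousAt
  have cA : Continuous A := continuous_iff_continuousAt.2 fun x => (hAC x).continuousAt
  have cB : Continuous B := continuous_iff_continuousAt.2 fun x => (hBD x).continuousAt
  have cC : Continuous C := continuous_iff_continuousAt.2 fun x => (hCE x).continuousAt
  have int {g : ℝ → ℝ} (hg : Continuous g) :
      IntervalIntegrable g MeasureTheory.volume 0 1 := hg.intervalIntegrable _ _
  -- `S` is the stress and `P` the flux, whose boundary values vanish.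
  let S : ℝ → ℝ := fun x => (1 - v ^ 2) * B x + (b / 2) * B x ^ 3 + η * (B x ^ 2 * C x)
  let S' : ℝ → ℝ := fun x => (1 - v ^ 2 + (3 / 2) * b * B x ^ 2) * D x
    + 2 * η * B x * D x * C x + η * B x ^ 2 * E x
  have hS (x : ℝ) : HasDerivAt S (S' x) x := by
    refine HasDerivAt.congr_deriv (((((hBD x).const_mul (1 - v ^ 2)).add (((hBD x).pow 3).const_mul (b / 2))).add
      ((((hBD x).pow 2).mul (hCE x)).const_mul η))) ?_
    simp [S']
    ring
  let P : ℝ → ℝ := fun x => A x * S x - v * A x ^ 2 + δ * (Y x * (S x - 2 * v * A x))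
  let P' : ℝ → ℝ := fun x => C x * S x + A x * S' x - 2 * v * (A x * C x)
    + δ * (B x * (S x - 2 * v * A x) + Y x * (S' x - 2 * v * C x))
  have hP (x : ℝ) : HasDerivAt P (P' x) x := by
    refine HasDerivAt.congr_deriv (((((hAC x).mul (hS x)).sub (((hAC x).pow 2).const_mul v)).add
      (((hYB x).mul ((hS x).sub ((hAC x).const_mul (2 * v)))).const_mul δ))) ?_
    simp [P']
    ring
  have cP' : Continuous P' := by
    simp only [P', S, S']
    fun_prop
  have hP0 : ∫ x in (0 : ℝ)..1, P' x = 0 := by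
    rw [intervalIntegral.integral_eq_sub_of_hasDerivAt (fun x _ => hP x) (int cP')]
    simp [P, hY0, hY1, hA0, hA1]
  have hmono := intervalIntegral.integral_mono_on_of_le_Ioo (μ := MeasureTheory.volume)
    (a := 0) (b := 1)
    (f := fun x => (A x * T x + (1 - v ^ 2) * (B x * C x) + (b / 2) * (B x ^ 3 * C x))
      + δ * (A x ^ 2 + Y x * T x + 2 * δ * (Y x * A x) + η * (B x ^ 3 * C x)))
    (g := fun x => -(δ * (1 - v)) * A x ^ 2 - δ * (1 - v - v ^ 2) * B x ^ 2
      - (b * δ / 2) * B x ^ 4 - η * (B x ^ 2 * C x ^ 2) + P' x)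
    zero_le_one (int (by fun_prop)) (int (by fun_prop)) (fun x hx => by
      have hTx : T x = S' x - 2 * δ * A x - 2 * v * C x := by
        simp only [S']
        linarith [hpde x hx]
      have hsq : 0 ≤ δ * v * (A x - B x) ^ 2 := by positivity
      simp only [P', S, hTx]
      nlinarith [hsq])
  rw [intervalIntegral.integral_add (int (by fun_prop)) (int (by fun_prop)),
    intervalIntegral.integral_const_mul,
    intervalIntegral.integral_add (int (by fun_prop)) (int cP'),
    intervalIntegral.integral_sub (int (by fun_prop)) (int (by fun_prop)),
    intervalIntegral.integral_sub (int (by fun_prop)) (int (by fun_prop)),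
    intervalIntegral.integral_sub (int (by fun_prop)) (int (by fun_prop)),
    intervalIntegral.integral_const_mul, intervalIntegral.integral_const_mul,
    intervalIntegral.integral_const_mul, intervalIntegral.integral_const_mul, hP0,
    add_zero] at hmono
  exact hmono

/-- Along C³ solutions of the Kelvin–Voigt moving-string PDE, the Lyapunov
function `V` is differentiable and its derivative satisfies the dissipation
inequality of Eq. (24). -/
theorem stmt_11 (b δ η v : ℝ) (hb : 0 < b) (hδ : 0 < δ) (hη : 0 < η)
    (hv0 : 0 ≤ v) (hv1 : v < 1)
    (y : ℝ → ℝ → ℝ)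
    (hy : ContDiff ℝ 3 (Function.uncurry y))
    (hpde : ∀ x ∈ Set.Ioo (0:ℝ) 1, ∀ t : ℝ, 0 ≤ t →
      pdt (pdt y) x t + 2 * δ * pdt y x t + 2 * v * pdx (pdt y) x t
        = (1 - v ^ 2 + (3/2) * b * (pdx y x t) ^ 2) * pdx (pdx y) x t
          + 2 * η * pdx y x t * pdx (pdx y) x t * pdx (pdt y) x t
          + η * (pdx y x t) ^ 2 * pdx (pdx (pdt y)) x t)
    (hbc : ∀ t : ℝ, 0 ≤ t → y 0 t = 0 ∧ y 1 t = 0)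
    (V : ℝ → ℝ)
    (hV : ∀ t : ℝ, V t =
      (∫ x in (0:ℝ)..1,
        ((1/2) * (pdt y x t) ^ 2 + (1/2) * (1 - v ^ 2) * (pdx y x t) ^ 2
          + (b/8) * (pdx y x t) ^ 4))
      + δ * ∫ x in (0:ℝ)..1,
        (y x t * pdt y x t + δ * (y x t) ^ 2 + (η/4) * (pdx y x t) ^ 4)) :
    ∀ t : ℝ, 0 ≤ t → DifferentiableAt ℝ V t ∧
      deriv V t ≤
        -(δ * (1 - v)) * (∫ x in (0:ℝ)..1, (pdt y x t) ^ 2)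
        - δ * (1 - v - v ^ 2) * (∫ x in (0:ℝ)..1, (pdx y x t) ^ 2)
        - (b * δ / 2) * (∫ x in (0:ℝ)..1, (pdx y x t) ^ 4)
        - η * ∫ x in (0:ℝ)..1, (pdx y x t) ^ 2 * (pdx (pdt y) x t) ^ 2 := by
  intro t ht
  have h3 : ContDiff ℝ ((2 : ℕ) + 1) (Function.uncurry y) := by
    convert hy using 1; norm_num
  have hX : ContDiff ℝ ((1 : ℕ) + 1) (Function.uncurry (pdx y)) := by
    convert pdx_contDiff h3 using 1; norm_num
  have hT : ContDiff ℝ ((1 : ℕ) + 1) (Function.uncurry (pdt y)) := by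
    convert pdt_contDiff h3 using 1; norm_num
  have hXX : ContDiff ℝ ((0 : ℕ) + 1) (Function.uncurry (pdx (pdx y))) := by
    simpa using pdx_contDiff hX
  have hXT : ContDiff ℝ ((0 : ℕ) + 1) (Function.uncurry (pdx (pdt y))) := by
    simpa using pdx_contDiff hT
  have hTT : ContDiff ℝ ((0 : ℕ) + 1) (Function.uncurry (pdt (pdt y))) := by
    simpa using pdt_contDiff hT
  have hXXT := pdx_contDiff hXT
  have cY := h3.continuous
  have cX := hX.continuous
  have cT := hT.continuous
  have cXT := hXT.continuous
  have cTT := hTT.continuous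
  have slice {f : ℝ → ℝ → ℝ} (hf : Continuous (Function.uncurry f)) (s : ℝ) :
      Continuous fun x => f x s := hf.comp (continuous_id.prodMk continuous_const)
  have dY := pdt_hasDerivAt h3
  have dT := pdt_hasDerivAt hT
  have dX (x s : ℝ) : HasDerivAt (fun s' => pdx y x s') (pdx (pdt y) x s) s := by
    rw [← pdt_pdx_comm (hy.of_le (by norm_num))]
    exact pdt_hasDerivAt hX x s
  have hV1 := hasDerivAt_intervalIntegral_of_continuous (a := 0) (b := 1)
    (f := fun x s => (1/2) * (pdt y x s) ^ 2 + (1/2) * (1 - v ^ 2) * (pdx y x s) ^ 2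
          + (b/8) * (pdx y x s) ^ 4)
    (f' := fun x s => pdt y x s * pdt (pdt y) x s
      + (1 - v ^ 2) * (pdx y x s * pdx (pdt y) x s) + (b / 2) * (pdx y x s ^ 3 * pdx (pdt y) x s))
    (fun s => by
      have := slice cX s
      have := slice cT s
      fun_prop)
    (by
      simp only [Function.uncurry_def] at *
      fun_prop)
    (fun x s => by
      refine HasDerivAt.congr_deriv (((((dT x s).pow 2).const_mul (1/2)).add
        (((dX x s).pow 2).const_mul ((1/2) * (1 - v ^ 2)))).add
        (((dX x s).pow 4).const_mul (b/8))) ?_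
      simp
      ring) t
  have hV2 := hasDerivAt_intervalIntegral_of_continuous (a := 0) (b := 1)
    (f := fun x s => y x s * pdt y x s + δ * (y x s) ^ 2 + (η/4) * (pdx y x s) ^ 4)
    (f' := fun x s => pdt y x s ^ 2 + y x s * pdt (pdt y) x s
      + 2 * δ * (y x s * pdt y x s) + η * (pdx y x s ^ 3 * pdx (pdt y) x s))
    (fun s => by
      have := slice cX s
      have := slice cT s
      have := slice cY s
      fun_prop)
    (by
      simp only [Function.uncurry_def] at *
      fun_prop)
    (fun x s => by
      refine HasDerivAt.congr_deriv ((((dY x s).mul (dT x s)).add (((dY x s).pow 2).const_mul δ)).add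
        (((dX x s).pow 4).const_mul (η/4))) ?_
      simp
      ring) t
  have hVt := hV1.add (hV2.const_mul δ)
  have hVt' := hVt.congr_of_eventuallyEq (f₁ := V) (Filter.Eventually.of_forall hV)
  refine ⟨hVt'.differentiableAt, ?_⟩
  rw [hVt'.deriv]
  exact slice_dissipation_le hδ hv0 (fun x => pdx_hasDerivAt h3 x t)
    (fun x => pdx_hasDerivAt hT x t) (fun x => pdx_hasDerivAt hX x t)
    (fun x => pdx_hasDerivAt hXT x t) (slice hXXT.continuous t) (slice hXX.continuous t)
    (slice cTT t) (fun x hx => hpde x hx t ht) (hbc t ht).1 (hbc t ht).2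
    (pdt_eq_zero_of_forall_ge (dY 0 t) fun s hs => (hbc s (ht.trans hs)).1)
    (pdt_eq_zero_of_forall_ge (dY 1 t) fun s hs => (hbc s (ht.trans hs)).2)
end
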